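/- arXiv:2210.08447 — 4 statements merged into one kernel-verified Lean document; each statement's English description precedes it below -/
import Mathlib

section
/- For any positive integers k, B, and N, there exist N distinct positive integers a_0, ..., a_{N-1} with the following properties, where d_{mn} = a_m - a_n: (1) for all m ≠ n, d_{mn} divides gcd(a_m, a_n); (2) for all m ≠ n, d_k(B·a_n)·d_k(B·a_m/d_{mn}) = d_k(B·a_m)·d_k(B·a_n/d_{mn}). -/
/-- `dk k n` is the number of divisors `m` of `n` with `gcd(m, k) = 1`. -/
def dk (k n : ℕ) : ℕ := (n.divisors.filter fun m => Nat.gcd m k = 1).card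

open ArithmeticFunction ArithmeticFunction.zeta in
theorem exists_isMultiplicative_eq_dk (k : ℕ) :
    ∃ f : ArithmeticFunction ℕ, f.IsMultiplicative ∧ ∀ n, f n = dk k n := by
  let χ : ArithmeticFunction ℕ := ⟨fun n => if n ≠ 0 ∧ n.gcd k = 1 then 1 else 0, by simp⟩
  have hχ : χ.IsMultiplicative := by
    refine IsMultiplicative.iff_ne_zero.2 ⟨by simp [χ], ?_⟩
    intro m n hm hn _
    have := @Nat.coprime_mul_iff_left m n k
    simp only [Nat.Coprime] at this
    simp only [χ, coe_mk, this]
    by_cases h1 : m.gcd k = 1 <;> by_cases h2 : n.gcd k = 1 <;> simp [h1, h2, hm, hn]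
  refine ⟨χ * (ζ : ArithmeticFunction ℕ), hχ.mul isMultiplicative_zeta, fun x => ?_⟩
  rw [← natCoe_nat ζ, coe_mul_zeta_apply, dk, Finset.card_filter]
  refine Finset.sum_congr rfl fun i hi => ?_
  have : i ≠ 0 := (Nat.pos_of_mem_divisors hi).ne'
  simp [χ, this]

theorem dk_mul (k : ℕ) {m n : ℕ} (h : m.Coprime n) : dk k (m * n) = dk k m * dk k n := by
  obtain ⟨f, hf, hfk⟩ := exists_isMultiplicative_eq_dk k
  simpa only [hfk] using hf.map_mul_of_coprime h

theorem dk_mul_mul (k : ℕ) {m n : ℕ} (h : m.Coprime n) (x : ℕ) :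
    dk k (m * n * x) * dk k x = dk k (m * x) * dk k (n * x) := by
  obtain ⟨f, hf, hfk⟩ := exists_isMultiplicative_eq_dk k
  have := hf.lcm_apply_mul_gcd_apply (x := m * x) (y := n * x)
  rwa [Nat.lcm_mul_right, Nat.gcd_mul_right, h.gcd_eq_one, one_mul, h.lcm_eq_mul, hfk, hfk, hfk,
    hfk] at this

theorem dk_pos (k : ℕ) {n : ℕ} (h : 0 < n) : 0 < dk k n :=
  Finset.card_pos.2 ⟨1, by simp [h.ne']⟩

theorem dk_prime_pow {k r : ℕ} (hr : r.Prime) (hk : r.Coprime k) (j : ℕ) :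
    dk k (r ^ j) = j + 1 := by
  rw [dk, Finset.filter_true_of_mem, Nat.divisors_prime_pow hr, Finset.card_map,
    Finset.card_range]
  intro m hm
  obtain ⟨i, _, rfl⟩ := (Nat.mem_divisors_prime_pow hr j).1 hm
  exact Nat.Coprime.pow_left i hk

theorem dk_prime_mul_of_modEq {k r x u : ℕ} (hr : r.Prime) (hk : r.Coprime k)
    (hx : x ≡ r ^ u [MOD r ^ (u + 1)]) : dk k (r * x) * (u + 1) = (u + 2) * dk k x := by
  obtain ⟨t, rfl⟩ : r ^ u ∣ x :=
    (Nat.ModEq.dvd_iff hx (pow_dvd_pow r u.le_succ)).2 dvd_rfl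
  have ht : t ≡ 1 [MOD r] := by
    refine Nat.ModEq.mul_left_cancel' (pow_ne_zero u hr.ne_zero) ?_
    rwa [mul_one, ← pow_succ]
  have htr : t.Coprime r := by rw [Nat.Coprime, ht.gcd_eq, Nat.gcd_one_left]
  rw [← mul_assoc, ← pow_succ', dk_mul k (htr.symm.pow_left _), dk_mul k (htr.symm.pow_left _),
    dk_prime_pow hr hk, dk_prime_pow hr hk]
  ring

theorem exists_mul_modEq {h M : ℕ} (hM : h.Coprime M) (v : ℕ) : ∃ x, h * x ≡ v [MOD M] := by
  obtain ⟨z, hz, hz'⟩ := Nat.chineseRemainder hM 0 v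
  obtain ⟨x, rfl⟩ := (Nat.modEq_zero_iff_dvd).1 hz
  exact ⟨x, hz'⟩

theorem exists_pos_modEq {S : Finset ℕ} {P : ℕ} (hP : 0 < P) (v : ℕ) {s : ℕ → ℕ} (a : ℕ → ℕ)
    (hs : ∀ i ∈ S, s i ≠ 0) (hsP : ∀ i ∈ S, P.Coprime (s i))
    (hss : ∀ i ∈ S, ∀ j ∈ S, i ≠ j → (s i).Coprime (s j)) :
    ∃ y, 0 < y ∧ y ≡ v [MOD P] ∧ ∀ i ∈ S, y ≡ a i [MOD s i] := by
  obtain ⟨z, hz⟩ := Nat.chineseRemainderOfFinset a s S hs fun i hi j hj hij => hss i hi j hj hij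
  obtain ⟨y, hy, hy'⟩ := Nat.chineseRemainder (Nat.Coprime.prod_right hsP) v z
  refine ⟨y + P * ∏ i ∈ S, s i, ?_, ?_, fun i hi => ?_⟩
  · exact Nat.add_pos_right _
      (Nat.mul_pos hP (Finset.prod_pos fun i hi => Nat.pos_of_ne_zero (hs i hi)))
  · simpa [Nat.ModEq] using hy
  · have hd : s i ∣ ∏ i ∈ S, s i := Finset.dvd_prod_of_mem s hi
    have h1 : P * ∏ i ∈ S, s i ≡ 0 [MOD s i] := Nat.modEq_zero_iff_dvd.2 (hd.mul_left P)
    simpa using ((hy'.of_dvd hd).trans (hz i hi)).add h1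

/-- The factor `s` by which `dk k (Q * (1 + h * δ)) / dk k (1 + h * δ)` exceeds
`dk k (Q * δ) / dk k δ` can be forced by a congruence on `δ`, for some `Q` free of prescribed
primes. -/
def RatioAttained (k h : ℕ) (s : ℚ) : Prop :=
  ∀ P, 0 < P → ∃ Q M δ₀ L : ℕ, 0 < M ∧ Q ∣ M ∧ M ∣ Q ^ L ∧ M.Coprime P ∧
    ∀ δ, δ ≡ δ₀ [MOD M] →
      (dk k (Q * (1 + h * δ)) * dk k δ : ℚ) = s * dk k (1 + h * δ) * dk k (Q * δ)

namespace RatioAttained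

variable {k h : ℕ}

theorem mul {s t : ℚ} (hs : RatioAttained k h s) (ht : RatioAttained k h t) :
    RatioAttained k h (s * t) := by
  intro P hP
  obtain ⟨Q₁, M₁, δ₁, L₁, hM₁, hQ₁, hL₁, hP₁, h₁⟩ := hs P hP
  obtain ⟨Q₂, M₂, δ₂, L₂, hM₂, hQ₂, hL₂, hP₂, h₂⟩ := ht (P * M₁) (Nat.mul_pos hP hM₁)
  have hMM : M₁.Coprime M₂ := hP₂.coprime_mul_left_right.symm
  have hQQ : Q₁.Coprime Q₂ := (hMM.of_dvd_left hQ₁).of_dvd_right hQ₂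
  obtain ⟨δ₀, hδ₁, hδ₂⟩ := Nat.chineseRemainder hMM δ₁ δ₂
  refine ⟨Q₁ * Q₂, M₁ * M₂, δ₀, L₁ + L₂, Nat.mul_pos hM₁ hM₂, mul_dvd_mul hQ₁ hQ₂, ?_,
    Nat.Coprime.mul_left hP₁ hP₂.coprime_mul_right_right, fun δ hδ => ?_⟩
  · rw [mul_pow]
    exact mul_dvd_mul (hL₁.trans (pow_dvd_pow _ (by lia))) (hL₂.trans (pow_dvd_pow _ (by lia)))
  · rcases Nat.eq_zero_or_pos δ with rfl | hpos
    · simp [dk]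
    have e₁ := h₁ δ ((hδ.of_dvd (dvd_mul_right _ _)).trans hδ₁)
    have e₂ := h₂ δ ((hδ.of_dvd (dvd_mul_left _ _)).trans hδ₂)
    have e₃ : (_ : ℚ) = _ := congrArg Nat.cast (dk_mul_mul k hQQ (1 + h * δ))
    have e₄ : (_ : ℚ) = _ := congrArg Nat.cast (dk_mul_mul k hQQ δ)
    push_cast at e₃ e₄
    have p₁ : (dk k δ : ℚ) ≠ 0 := by exact_mod_cast (dk_pos k hpos).ne'
    have p₂ : (dk k (1 + h * δ) : ℚ) ≠ 0 := by exact_mod_cast (dk_pos k (by lia)).ne'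
    refine mul_right_cancel₀ (mul_ne_zero p₁ p₂) ?_
    calc _ = (dk k (Q₁ * Q₂ * (1 + h * δ)) * dk k (1 + h * δ) : ℚ) * dk k δ * dk k δ := by ring
      _ = (dk k (Q₁ * (1 + h * δ)) * dk k δ : ℚ) * (dk k (Q₂ * (1 + h * δ)) * dk k δ) := by
        rw [e₃]; ring
      _ = s * t * dk k (1 + h * δ) * dk k (1 + h * δ) * (dk k (Q₁ * δ) * dk k (Q₂ * δ)) := by
        rw [e₁, e₂]; ring
      _ = _ := by rw [← e₄]; ring

theorem of_succ (hk : 0 < k) (hh : 0 < h) {u : ℕ} (hu : 0 < u) :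
    RatioAttained k h ((u + 2) / (2 * (u + 1))) := by
  intro P hP
  obtain ⟨r, hrP, hr⟩ := Nat.exists_infinite_primes (P * h * k + 1)
  have hco : r.Coprime (P * h * k) := (Nat.coprime_of_lt_prime (by positivity) (Nat.lt_of_succ_le hrP) hr)
  have hrk : r.Coprime k := hco.coprime_mul_left_right
  have hrh : r.Coprime h := hco.coprime_mul_right_right.coprime_mul_left_right
  obtain ⟨δ₀, hδ₀⟩ := exists_mul_modEq (hrh.symm.pow_right (u + 1)) (r ^ u - 1)
  refine ⟨r, r ^ (u + 1), δ₀, u + 1, pow_pos hr.pos _, dvd_pow_self _ (by lia), dvd_rfl,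
    hco.coprime_mul_right_right.coprime_mul_right_right.pow_left _, fun δ hδ => ?_⟩
  have hg : 1 + h * δ ≡ r ^ u [MOD r ^ (u + 1)] := by
    have := ((hδ.mul_left h).trans hδ₀).add_left 1
    rwa [Nat.add_sub_cancel' (Nat.one_le_pow _ _ hr.pos)] at this
  have hδr : r.Coprime δ := by
    rw [hr.coprime_iff_not_dvd]
    intro hd
    have h1 : r ∣ 1 + h * δ := (Nat.ModEq.dvd_iff hg (dvd_pow_self _ (by lia))).2
      (dvd_pow_self _ hu.ne')
    exact hr.one_lt.ne' (Nat.dvd_one.1 ((Nat.dvd_add_left (hd.mul_left h)).1 h1))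
  have e₁ : (_ : ℚ) = _ := congrArg Nat.cast (dk_prime_mul_of_modEq hr hrk hg)
  have e₂ := dk_mul k hδr
  rw [← pow_one r, dk_prime_pow hr hrk, pow_one] at e₂
  rw [e₂]
  push_cast at e₁ ⊢
  field_simp
  linear_combination (dk k δ : ℚ) * e₁

theorem of_succ_inv (hk : 0 < k) {u : ℕ} (hu : 0 < u) :
    RatioAttained k h (2 * (u + 1) / (u + 2)) := by
  intro P hP
  obtain ⟨r, hrP, hr⟩ := Nat.exists_infinite_primes (P * k + 1)
  have hco : r.Coprime (P * k) := (Nat.coprime_of_lt_prime (by positivity) (Nat.lt_of_succ_le hrP) hr)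
  have hrk : r.Coprime k := hco.coprime_mul_left_right
  refine ⟨r, r ^ (u + 1), r ^ u, u + 1, pow_pos hr.pos _, dvd_pow_self _ (by lia), dvd_rfl,
    hco.coprime_mul_right_right.pow_left _, fun δ hδ => ?_⟩
  have hg : r.Coprime (1 + h * δ) := by
    have h1 : r ∣ δ := (Nat.ModEq.dvd_iff hδ (dvd_pow_self _ (by lia))).2
      (dvd_pow_self _ hu.ne')
    rw [hr.coprime_iff_not_dvd]
    intro hd
    exact hr.one_lt.ne' (Nat.dvd_one.1 ((Nat.dvd_add_left (h1.mul_left h)).1 hd))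
  have e₁ : (_ : ℚ) = _ := congrArg Nat.cast (dk_prime_mul_of_modEq hr hrk hδ)
  have e₂ := dk_mul k hg
  rw [← pow_one r, dk_prime_pow hr hrk, pow_one] at e₂
  rw [e₂]
  push_cast at e₁ ⊢
  field_simp
  linear_combination (-dk k (1 + h * δ) : ℚ) * e₁

theorem natCast_and_inv (hk : 0 < k) (hh : 0 < h) {n : ℕ} (hn : 0 < n) :
    RatioAttained k h n ∧ RatioAttained k h (n : ℚ)⁻¹ := by
  have t := fun u hu => @of_succ k h hk hh u hu
  have t' := fun u hu => @of_succ_inv k h hk u hu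
  have half : RatioAttained k h (1 / 2) := by
    convert (t 1 one_pos).mul (t 2 two_pos) using 1; norm_num
  have two : RatioAttained k h 2 := by
    convert (t' 1 one_pos).mul (t' 2 two_pos) using 1; norm_num
  induction n, hn using Nat.le_induction with
  | base => constructor <;> (convert half.mul two using 1; norm_num)
  | succ n hn ih =>
    rcases Nat.lt_or_ge n 2 with h2 | h2
    · obtain rfl : n = 1 := by lia
      exact ⟨by convert two using 1; norm_num, by convert half using 1; norm_num⟩
    · obtain ⟨u, rfl⟩ : ∃ u, n = u + 1 := ⟨n - 1, by lia⟩
      constructor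
      · convert (ih.1.mul two).mul (t u (by lia)) using 1
        push_cast; field_simp; ring
      · convert (ih.2.mul half).mul (t' u (by lia)) using 1
        push_cast; field_simp; ring

theorem of_pos (hk : 0 < k) (hh : 0 < h) {s : ℚ} (hs : 0 < s) : RatioAttained k h s := by
  have hnum : 0 < s.num.natAbs := Int.natAbs_pos.2 (Rat.num_pos.2 hs).ne'
  convert (natCast_and_inv hk hh hnum).1.mul (natCast_and_inv hk hh s.den_pos).2 using 1
  have h1 : ((s.num.natAbs : ℕ) : ℚ) = s.num := by
    rw [← Int.cast_natCast, Int.natAbs_of_nonneg (Rat.num_pos.2 hs).le]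
  rw [h1, ← div_eq_mul_inv, Rat.num_div_den]

theorem exists_family {h : ℕ → ℕ} {s : ℕ → ℚ} {P : ℕ} (hP : 0 < P) (S : Finset ℕ)
    (hS : ∀ a ∈ S, RatioAttained k (h a) (s a)) :
    ∃ Q M δ₀ L : ℕ → ℕ, (∀ a ∈ S, 0 < M a ∧ Q a ∣ M a ∧ M a ∣ Q a ^ L a ∧ (M a).Coprime P ∧
      ∀ δ, δ ≡ δ₀ a [MOD M a] → (dk k (Q a * (1 + h a * δ)) * dk k δ : ℚ) =
        s a * dk k (1 + h a * δ) * dk k (Q a * δ)) ∧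
      ∀ a ∈ S, ∀ b ∈ S, a ≠ b → (M a).Coprime (M b) := by
  induction S using Finset.induction with
  | empty => exact ⟨0, 0, 0, 0, by simp⟩
  | insert c S hc ih =>
    obtain ⟨Q, M, δ₀, L, hS₁, hS₂⟩ := ih fun a ha => hS a (Finset.mem_insert_of_mem ha)
    obtain ⟨q, m, δ, l, hm, hqm, hml, hmP, hδ⟩ := hS c (Finset.mem_insert_self c S)
      (P * ∏ a ∈ S, M a) (Nat.mul_pos hP (Finset.prod_pos fun a ha => (hS₁ a ha).1))
    have hne : ∀ a ∈ S, a ≠ c := fun a ha h => hc (h ▸ ha)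
    have hmM : ∀ a ∈ S, m.Coprime (M a) := fun a ha =>
      hmP.coprime_mul_left_right.of_dvd_right (Finset.dvd_prod_of_mem M ha)
    refine ⟨Function.update Q c q, Function.update M c m, Function.update δ₀ c δ,
      Function.update L c l, fun a ha => ?_, fun a ha b hb hab => ?_⟩
    · rcases Finset.mem_insert.1 ha with rfl | ha
      · simpa using ⟨hm, hqm, hml, hmP.coprime_mul_right_right, hδ⟩
      · simpa [hne a ha] using hS₁ a ha
    · rcases Finset.mem_insert.1 ha with rfl | ha' <;> rcases Finset.mem_insert.1 hb with rfl | hb'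
      · exact absurd rfl hab
      · simpa [hne b hb'] using hmM b hb'
      · simpa [hne a ha'] using (hmM a ha').symm
      · simpa [hne a ha', hne b hb'] using hS₂ a ha' b hb' hab

end RatioAttained

/-- The divisibility and divisor-count conditions of `key_lemma`, for a finite set. -/
def IsBalanced (k B : ℕ) (S : Finset ℕ) : Prop :=
  ∀ a ∈ S, 0 < a ∧ ∀ b ∈ S, b < a → a - b ∣ b ∧
    dk k (B * b) * dk k (B * a / (a - b)) = dk k (B * a) * dk k (B * b / (a - b))

theorem dk_balanced_shift {k B P a b x : ℕ} (ha : B * a ∣ P) (hb : B * b ∣ P)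
    (hxa : a * P ∣ x) (hxb : b * P ∣ x)
    (hda : a - b ∣ a) (hdb : a - b ∣ b)
    (h : dk k (B * b) * dk k (B * a / (a - b)) = dk k (B * a) * dk k (B * b / (a - b))) :
    dk k (B * (x + b)) * dk k (B * (x + a) / (a - b)) =
      dk k (B * (x + a)) * dk k (B * (x + b) / (a - b)) := by
  have key : ∀ c, B * c ∣ P → c * P ∣ x → a - b ∣ c → ∃ γ,
      dk k (B * (x + c)) = dk k (B * c) * γ ∧
      dk k (B * (x + c) / (a - b)) = dk k (B * c / (a - b)) * γ := by
    rintro c hcP ⟨t, rfl⟩ hd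
    have hco : P.Coprime (P * t + 1) := by simp
    have e : B * (c * P * t + c) = B * c * (P * t + 1) := by ring
    have hd' : a - b ∣ B * c := hd.mul_left B
    refine ⟨dk k (P * t + 1), ?_, ?_⟩
    · rw [e, dk_mul k (hco.of_dvd_left hcP)]
    · rw [e, ← Nat.div_mul_right_comm hd',
        dk_mul k (hco.of_dvd_left ((Nat.div_dvd_of_dvd hd').trans hcP))]
  obtain ⟨γ, h₁, h₂⟩ := key a ha hxa hda
  obtain ⟨γ', h₃, h₄⟩ := key b hb hxb hdb
  rw [h₁, h₂, h₃, h₄]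
  linear_combination γ * γ' * h

theorem IsBalanced.exists_card_succ {k B : ℕ} {S : Finset ℕ} (hk : 0 < k) (hB : 0 < B)
    (hS : IsBalanced k B S) : ∃ T : Finset ℕ, T.card = S.card + 1 ∧ IsBalanced k B T := by
  set P := 2 * B * ∏ a ∈ S, a with hPdef
  have hpos : ∀ a ∈ S, 0 < a := fun a ha => (hS a ha).1
  have hP : 0 < P := by
    have := Finset.prod_pos hpos
    positivity
  have hBaP : ∀ a ∈ S, B * a ∣ P := fun a ha => by
    rw [hPdef, mul_assoc]
    exact (mul_dvd_mul_left B (Finset.dvd_prod_of_mem _ ha)).mul_left 2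
  have haP : ∀ a ∈ S, a ∣ P := fun a ha => (dvd_mul_left a B).trans (hBaP a ha)
  have hBP : B ∣ P := (dvd_mul_left B 2).mul_right _
  have h2P : 2 ∣ P := (dvd_mul_right 2 B).mul_right _
  set h : ℕ → ℕ := fun a => P ^ 2 / a with hh
  have ah : ∀ a ∈ S, a * h a = P ^ 2 := fun a ha =>
    Nat.mul_div_cancel' ((haP a ha).trans (dvd_pow_self P two_ne_zero))
  have hPh : ∀ a ∈ S, P ∣ h a := fun a ha =>
    (mul_dvd_mul_iff_left (hpos a ha).ne').1 (by
      rw [ah a ha, sq]; exact mul_dvd_mul_right (haP a ha) P)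
  have hhP : ∀ a ∈ S, h a ∣ P ^ 2 := fun a ha => ⟨a, by rw [mul_comm, ah a ha]⟩
  have hh0 : ∀ a ∈ S, 0 < h a := fun a ha => Nat.pos_of_dvd_of_pos (hhP a ha) (by positivity)
  set s : ℕ → ℚ := fun a =>
    (dk k (B * P ^ 2) * dk k B : ℚ) / (dk k (B * a) * dk k (B * h a)) with hs
  have hs0 : ∀ a ∈ S, 0 < s a := fun a ha => by
    have h1 := dk_pos k hB
    have h2 := dk_pos k (Nat.mul_pos hB (hpos a ha))
    have h3 := dk_pos k (Nat.mul_pos hB (hh0 a ha))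
    have h4 := dk_pos k (n := B * P ^ 2) (by positivity)
    rw [← Nat.cast_pos (α := ℚ)] at h1 h2 h3 h4
    exact div_pos (mul_pos h4 h1) (mul_pos h2 h3)
  obtain ⟨Q, M, δ₀, L, hQM, hMM⟩ := RatioAttained.exists_family hP S
    fun a ha => RatioAttained.of_pos hk (hh0 a ha) (hs0 a ha)
  have hM0 : ∀ a ∈ S, 0 < M a := fun a ha => (hQM a ha).1
  have hQdM : ∀ a ∈ S, Q a ∣ M a := fun a ha => (hQM a ha).2.1
  have hMQ : ∀ a ∈ S, M a ∣ Q a ^ L a := fun a ha => (hQM a ha).2.2.1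
  have hMP : ∀ a ∈ S, (M a).Coprime P := fun a ha => (hQM a ha).2.2.2.1
  have hQ0 : ∀ a ∈ S, 0 < Q a := fun a ha => Nat.pos_of_dvd_of_pos (hQdM a ha) (hM0 a ha)
  have hQMP : ∀ a ∈ S, (Q a * M a).Coprime P := fun a ha =>
    ((hMP a ha).of_dvd_left (hQdM a ha)).mul_left (hMP a ha)
  have hhM : ∀ a ∈ S, (h a).Coprime (M a) := fun a ha =>
    (((hMP a ha).pow_right 2).of_dvd_right (hhP a ha)).symm
  -- `w` makes `a + P ^ 2 * w = a * c a` with `Q a` an exact divisor of `c a`.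
  have hW : ∀ a ∈ S, ∃ W, h a * W ≡ Q a * M a - 1 + Q a [MOD Q a * M a] := fun a ha =>
    exists_mul_modEq (((hQMP a ha).symm.pow_left 2).of_dvd_left (hhP a ha)) _
  choose! W hW using hW
  obtain ⟨w, -, -, hw⟩ := exists_pos_modEq (S := S) (P := 1) one_pos 0
    (s := fun a => Q a * M a) W (fun a ha => (Nat.mul_pos (hQ0 a ha) (hM0 a ha)).ne')
    (fun a ha => Nat.coprime_one_left _) (fun a ha b hb hab => by
      have hab' := hMM a ha b hb hab
      exact Nat.Coprime.mul_left
        (((hab'.of_dvd_left (hQdM a ha)).of_dvd_right (hQdM b hb)).mul_right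
          (hab'.of_dvd_left (hQdM a ha)))
        ((hab'.of_dvd_right (hQdM b hb)).mul_right hab'))
  set c : ℕ → ℕ := fun a => h a * w + 1 with hc
  have hac : ∀ a ∈ S, a * c a = P ^ 2 * w + a := fun a ha => by
    rw [← ah a ha]; ring
  have hcP : ∀ a ∈ S, (c a).Coprime P := fun a ha => by
    have : (h a * w + 1).Coprime (h a) := by simp
    exact this.of_dvd_right (hPh a ha)
  have hcQ : ∀ a ∈ S, ∃ c', c a = Q a * c' ∧ c'.Coprime (M a) := fun a ha => by
    have hQMpos := Nat.mul_pos (hQ0 a ha) (hM0 a ha)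
    have h1 : c a ≡ Q a [MOD Q a * M a] := by
      have := (((hw a ha).mul_left (h a)).trans (hW a ha)).add_right 1
      refine this.trans ?_
      rw [show Q a * M a - 1 + Q a + 1 = Q a + Q a * M a by lia]
      simp [Nat.ModEq]
    obtain ⟨c', hc'⟩ : Q a ∣ c a := (h1.dvd_iff (dvd_mul_right _ _)).2 dvd_rfl
    refine ⟨c', hc', ?_⟩
    rw [hc'] at h1
    have h2 : c' ≡ 1 [MOD M a] :=
      Nat.ModEq.mul_left_cancel' (hQ0 a ha).ne' (by rwa [mul_one])
    rw [Nat.Coprime, h2.gcd_eq, Nat.gcd_one_left]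
  choose! c' hc' hc'M using hcQ
  have hc'c : ∀ a ∈ S, c' a ∣ c a := fun a ha => ⟨Q a, by rw [hc' a ha, mul_comm]⟩
  have hc'P : ∀ a ∈ S, (c' a).Coprime P := fun a ha => (hcP a ha).of_dvd_left (hc'c a ha)
  have hcc_lt : ∀ a ∈ S, ∀ b ∈ S, b < a → (c a).Coprime (c b) := fun a ha b hb hba => by
    refine Nat.Coprime.symm (Nat.coprime_of_dvd fun p hp hpb hpa => ?_)
    have h1 : p ∣ a - b := by
      have := Nat.dvd_sub (hpa.mul_left a) (hpb.mul_left b)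
      rwa [hac a ha, hac b hb, Nat.add_sub_add_left] at this
    have h2 : p ∣ P := h1.trans ((((hS a ha).2 b hb hba).1).trans (haP b hb))
    exact hp.one_lt.ne' (Nat.dvd_one.1 ((hcP a ha) ▸ Nat.dvd_gcd hpa h2))
  have hcc : ∀ a ∈ S, ∀ b ∈ S, a ≠ b → (c a).Coprime (c b) := fun a ha b hb hab => by
    rcases lt_or_gt_of_ne hab with hlt | hlt
    · exact (hcc_lt b hb a ha hlt).symm
    · exact hcc_lt a ha b hb hlt
  have hδ : ∀ a ∈ S, ∃ δ, δ ≡ δ₀ a [MOD M a] ∧ h a * δ ≡ 1 [MOD c' a] := fun a ha => by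
    obtain ⟨D, hD⟩ := exists_mul_modEq
      ((((hc'P a ha).pow_right 2).of_dvd_right (hhP a ha)).symm) 1
    obtain ⟨δ, h1, h2⟩ := Nat.chineseRemainder (hc'M a ha).symm (δ₀ a) D
    exact ⟨δ, h1, (h2.mul_left _).trans hD⟩
  choose! δ₁ hδ₁ hδ₁' using hδ
  have hmod : ∀ a ∈ S, c a * (M a * c' a) ∣ c a ^ (L a + 2) := fun a ha => by
    have hQc : Q a ∣ c a := ⟨c' a, hc' a ha⟩
    have h1 : M a ∣ c a ^ L a := (hMQ a ha).trans (pow_dvd_pow_of_dvd hQc _)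
    calc c a * (M a * c' a) ∣ c a * (c a ^ L a * c a) :=
          mul_dvd_mul_left _ (mul_dvd_mul h1 (hc'c a ha))
      _ = c a ^ (L a + 2) := by ring
  obtain ⟨y, hy0, hyP, hy⟩ := exists_pos_modEq (S := S) hP 1
    (s := fun a => c a * (M a * c' a)) (fun a => c a * δ₁ a)
    (fun a ha => by
      have h1 : c a ≠ 0 := Nat.succ_ne_zero _
      have h2 : c' a ≠ 0 := fun h0 => h1 (by rw [hc' a ha, h0, mul_zero])
      exact mul_ne_zero h1 (mul_ne_zero (hM0 a ha).ne' h2))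
    (fun a ha => (((hcP a ha).symm.pow_right _).of_dvd_right (hmod a ha)))
    (fun a ha b hb hab => (((hcc a ha b hb hab).pow _ _).of_dvd_left
      (hmod a ha)).of_dvd_right (hmod b hb))
  have hyco : y.Coprime P := by rw [Nat.Coprime, hyP.gcd_eq, Nat.gcd_one_left]
  set x := P ^ 2 * w + P ^ 2 * y with hx
  have hxS : ∀ a ∈ S, a * P ∣ x := fun a ha => by
    have : a * P ∣ P ^ 2 := by rw [sq]; exact mul_dvd_mul_right (haP a ha) P
    exact (this.mul_right w).add (this.mul_right y)
  have hlt : ∀ a ∈ S, P ^ 2 * y < x + a := fun a ha => by have := hpos a ha; lia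
  refine ⟨insert (P ^ 2 * y) (S.image (x + ·)), ?_, ?_⟩
  · rw [Finset.card_insert_of_notMem, Finset.card_image_of_injective _ (add_right_injective x)]
    intro hmem
    obtain ⟨a, ha, he⟩ := Finset.mem_image.1 hmem
    exact (hlt a ha).ne' he
  intro u hu
  rcases Finset.mem_insert.1 hu with rfl | hu
  · refine ⟨by positivity, fun v hv hvu => ?_⟩
    rcases Finset.mem_insert.1 hv with rfl | hv
    · exact absurd hvu (lt_irrefl _)
    · obtain ⟨a, ha, rfl⟩ := Finset.mem_image.1 hv
      exact absurd hvu (hlt a ha).le.not_gt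
  obtain ⟨a, ha, rfl⟩ := Finset.mem_image.1 hu
  refine ⟨Nat.add_pos_right x (hpos a ha), fun v hv hvu => ?_⟩
  rcases Finset.mem_insert.1 hv with rfl | hv
  · have hsub : x + a - P ^ 2 * y = a * c a := by rw [hac a ha]; lia
    have hyc := hy a ha
    obtain ⟨δ, rfl⟩ : c a ∣ y := (hyc.dvd_iff (dvd_mul_right _ _)).2 (dvd_mul_right _ _)
    have hc0 : c a ≠ 0 := Nat.succ_ne_zero _
    have hδM : δ ≡ δ₁ a [MOD M a * c' a] := Nat.ModEq.mul_left_cancel' hc0 hyc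
    have hratio := (hQM a ha).2.2.2.2 δ ((hδM.of_dvd (dvd_mul_right _ _)).trans (hδ₁ a ha))
    have hhδ : h a * δ ≡ 1 [MOD c' a] :=
      ((hδM.of_dvd (dvd_mul_left _ _)).mul_left _).trans (hδ₁' a ha)
    set g := 1 + h a * δ with hg
    have hδc' : δ.Coprime (c' a) := by
      have : (h a * δ).Coprime (c' a) := by rw [Nat.Coprime, hhδ.gcd_eq, Nat.gcd_one_left]
      exact this.coprime_mul_left
    have hgc' : g.Coprime (c' a) := by
      have : g ≡ 2 [MOD c' a] := hhδ.add_left 1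
      rw [Nat.Coprime, this.gcd_eq]
      exact ((hc'P a ha).of_dvd_right h2P).symm
    have hQc' : (Q a).Coprime (c' a) := ((hc'M a ha).of_dvd_right (hQdM a ha)).symm
    have hgP : g.Coprime P := by
      have : (1 + h a * δ).Coprime (h a) := by simp
      exact this.of_dvd_right (hPh a ha)
    have hga : a * c a * g = x + a := by
      rw [hg, mul_add, mul_one, hac a ha, hx, ← ah a ha]; ring
    have hya : P ^ 2 * (c a * δ) = a * c a * (h a * δ) := by rw [← ah a ha]; ring
    have hac0 : 0 < a * c a := Nat.mul_pos (hpos a ha) (Nat.pos_of_ne_zero hc0)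
    rw [hsub]
    refine ⟨⟨h a * δ, hya⟩, ?_⟩
    have e₁ : B * (x + a) / (a * c a) = B * g := by
      rw [← hga, mul_left_comm, Nat.mul_div_cancel_left _ hac0]
    have e₂ : B * (P ^ 2 * (c a * δ)) / (a * c a) = B * h a * δ := by
      rw [hya, mul_left_comm, Nat.mul_div_cancel_left _ hac0, mul_assoc]
    have hBP2 : B * P ^ 2 ∣ P ^ 3 := by rw [pow_succ' P 2]; exact mul_dvd_mul_right hBP _
    have hBh : B * h a ∣ P ^ 3 := (mul_dvd_mul_left B (hhP a ha)).trans hBP2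
    have f₁ : dk k (B * (P ^ 2 * (c a * δ))) =
        dk k (B * P ^ 2) * (dk k (Q a * δ) * dk k (c' a)) := by
      rw [← mul_assoc, dk_mul k ((hyco.symm.pow_left 3).of_dvd_left hBP2), hc' a ha,
        mul_right_comm, dk_mul k (hQc'.mul_left hδc')]
    have f₂ : dk k (B * (x + a)) = dk k (B * a) * (dk k (Q a * g) * dk k (c' a)) := by
      have hcg : (c a * g).Coprime P := (hcP a ha).mul_left hgP
      rw [← hga, mul_assoc, ← mul_assoc B, dk_mul k (hcg.symm.of_dvd_left (hBaP a ha)), hc' a ha,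
        mul_right_comm, dk_mul k (hQc'.mul_left hgc')]
    have f₃ : dk k (B * g) = dk k B * dk k g := dk_mul k (hgP.symm.of_dvd_left hBP)
    have f₄ : dk k (B * h a * δ) = dk k (B * h a) * dk k δ :=
      dk_mul k ((hyco.coprime_mul_left.symm.pow_left 3).of_dvd_left hBh)
    rw [e₁, e₂, f₁, f₂, f₃, f₄, ← Nat.cast_inj (R := ℚ)]
    have h2 : (dk k (B * a) : ℚ) ≠ 0 := by
      exact_mod_cast (dk_pos k (Nat.mul_pos hB (hpos a ha))).ne'
    have h3 : (dk k (B * h a) : ℚ) ≠ 0 := by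
      exact_mod_cast (dk_pos k (Nat.mul_pos hB (hh0 a ha))).ne'
    have hsa : s a * (dk k (B * a) * dk k (B * h a)) = dk k (B * P ^ 2) * dk k B :=
      div_mul_cancel₀ _ (mul_ne_zero h2 h3)
    push_cast
    linear_combination (-(dk k (Q a * δ) * dk k (c' a) * dk k g : ℚ)) * hsa -
      (dk k (B * a) * dk k (B * h a) * dk k (c' a) : ℚ) * hratio
  · obtain ⟨b, hb, rfl⟩ := Finset.mem_image.1 hv
    have hba : b < a := by simpa using hvu
    obtain ⟨hdb, hbal⟩ := (hS a ha).2 b hb hba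
    have hda : a - b ∣ a := by
      simpa [Nat.sub_add_cancel hba.le] using (dvd_refl (a - b)).add hdb
    simp only [Nat.add_sub_add_left]
    refine ⟨((hda.trans (dvd_mul_right a P)).trans (hxS a ha)).add hdb, ?_⟩
    exact dk_balanced_shift (hBaP a ha) (hBaP b hb) (hxS a ha) (hxS b hb) hda hdb
      hbal

theorem exists_isBalanced {k B : ℕ} (hk : 0 < k) (hB : 0 < B) (N : ℕ) :
    ∃ S : Finset ℕ, S.card = N ∧ IsBalanced k B S := by
  induction N with
  | zero => exact ⟨∅, rfl, by simp [IsBalanced]⟩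
  | succ N ih =>
    obtain ⟨S, rfl, hS⟩ := ih
    exact hS.exists_card_succ hk hB

theorem key_lemma (k B N : ℕ) (hk : 0 < k) (hB : 0 < B) (hN : 0 < N) :
    ∃ a : Fin N → ℕ,
      Function.Injective a ∧ (∀ n, 0 < a n) ∧
      (∀ m n : Fin N, m ≠ n → ((a m : ℤ) - (a n : ℤ)) ∣ (Nat.gcd (a m) (a n) : ℤ)) ∧
      (∀ m n : Fin N, a n < a m →
        dk k (B * a n) * dk k (B * a m / (a m - a n)) =
          dk k (B * a m) * dk k (B * a n / (a m - a n))) := by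
  obtain ⟨S, hcard, hS⟩ := exists_isBalanced hk hB N
  set a := S.orderEmbOfFin hcard
  have hmem : ∀ n, a n ∈ S := S.orderEmbOfFin_mem hcard
  have hdvd : ∀ m n, a n < a m → ((a m : ℤ) - (a n : ℤ)) ∣ (Nat.gcd (a m) (a n) : ℤ) := by
    intro m n hlt
    have hn := ((hS _ (hmem m)).2 _ (hmem n) hlt).1
    have hm : a m - a n ∣ a m := by
      simpa [Nat.sub_add_cancel hlt.le] using (dvd_refl (a m - a n)).add hn
    rw [← Nat.cast_sub hlt.le]
    exact_mod_cast Nat.dvd_gcd hm hn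
  refine ⟨a, a.injective, fun n => (hS _ (hmem n)).1, fun m n hmn => ?_,
    fun m n hlt => ((hS _ (hmem m)).2 _ (hmem n) hlt).2⟩
  rcases lt_or_gt_of_ne (a.injective.ne hmn) with hlt | hlt
  · rw [Nat.gcd_comm, ← neg_sub, neg_dvd]
    exact hdvd n m hlt
  · exact hdvd m n hlt
end

section
/- For every positive integer N there exist N distinct positive integers a_0, ..., a_{N-1} such that for all m ≠ n, the difference a_m - a_n divides gcd(a_m, a_n). -/
theorem exists_injective_sub_dvd (N : ℕ) :
    ∃ a : Fin N → ℕ, Function.Injective a ∧ (∀ n, 0 < a n) ∧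
      ∀ m n : Fin N, m ≠ n → ((a m : ℤ) - (a n : ℤ)) ∣ (a m : ℤ) := by
  induction N with
  | zero => exact ⟨Fin.elim0, fun i => i.elim0, fun i => i.elim0, fun i => i.elim0⟩
  | succ N ih =>
    obtain ⟨a, ha_inj, ha_pos, ha_dvd⟩ := ih
    set P : ℕ := ∏ i, a i
    have hP_pos : 0 < P := Finset.prod_pos fun i _ => ha_pos i
    have hP_dvd (i : Fin N) : (a i : ℤ) ∣ (P : ℤ) :=
      Int.natCast_dvd_natCast.mpr (Finset.dvd_prod_of_mem a (Finset.mem_univ i))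
    refine ⟨Fin.cons P fun i => P + a i, ?_, ?_, ?_⟩
    · rw [Fin.cons_injective_iff]
      refine ⟨?_, fun i j hij => ha_inj (Nat.add_left_cancel hij)⟩
      rintro ⟨i, hi⟩
      have := ha_pos i
      dsimp only at hi
      omega
    · intro n
      cases n using Fin.cases with
      | zero => simpa using hP_pos
      | succ i => simp only [Fin.cons_succ]; omega
    · intro m n hmn
      cases m using Fin.cases with
      | zero =>
        cases n using Fin.cases with
        | zero => exact absurd rfl hmn
        | succ j => simpa using hP_dvd j
      | succ i =>
        cases n using Fin.cases with
        | zero => simpa using hP_dvd i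
        | succ j =>
          have h := ha_dvd i j fun hij => hmn (congrArg Fin.succ hij)
          simpa using dvd_add (h.trans (hP_dvd i)) h

theorem diff_dvd_gcd_family (N : ℕ) (hN : 0 < N) :
    ∃ a : Fin N → ℕ,
      Function.Injective a ∧ (∀ n, 0 < a n) ∧
      ∀ m n : Fin N, m ≠ n → ((a m : ℤ) - (a n : ℤ)) ∣ (Nat.gcd (a m) (a n) : ℤ) := by
  obtain ⟨a, ha_inj, ha_pos, ha_dvd⟩ := exists_injective_sub_dvd N
  refine ⟨a, ha_inj, ha_pos, fun m n hmn => ?_⟩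
  have h := ha_dvd m n hmn
  rw [← Int.gcd_natCast_natCast]
  exact Int.dvd_coe_gcd h ((dvd_sub_right h).mp dvd_rfl)
end

section
/- Let k and B be positive integers, and let a > a' be positive integers with d = a - a' dividing both a and a'. Let r, F, r', F' be positive integers such that: (i) (B·a/d)·r'·F' = B + (B·a'/d)·r·F; (ii) the three numbers B·a'/d, r, F are pairwise coprime, and the three numbers B·a/d, r', F' are pairwise coprime; (iii) d_k(r) = d_k(B·a) and d_k(r') = d_k(B·a'); (iv) d_k(B·a')·d_k(B·a/d) = d_k(B·a)·d_k(B·a'/d); (v) d_k(F) = d_k(F'). Then the positive integer u = (B·a'/d)·r·F satisfies d_k(u) = d_k(u + B). -/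
theorem dk_mul_of_coprime (k : ℕ) {m n : ℕ} (hmn : m.Coprime n) :
    dk k (m * n) = dk k m * dk k n := by
  have himage : ((m * n).divisors.filter fun d => Nat.gcd d k = 1) =
      ((m.divisors.filter fun d => Nat.gcd d k = 1) ×ˢ
        (n.divisors.filter fun d => Nat.gcd d k = 1)).image fun p => p.1 * p.2 := by
    ext d
    simp only [Nat.divisors_mul, Finset.mem_filter, Finset.mem_mul, Finset.mem_image,
      Finset.mem_product, Prod.exists]
    constructor
    · rintro ⟨⟨x, hx, y, hy, rfl⟩, hd⟩
      obtain ⟨hxk, hyk⟩ := Nat.coprime_mul_iff_left.mp hd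
      exact ⟨x, y, ⟨⟨hx, hxk⟩, hy, hyk⟩, rfl⟩
    · rintro ⟨x, y, ⟨⟨hx, hxk⟩, hy, hyk⟩, rfl⟩
      exact ⟨⟨x, hx, y, hy, rfl⟩, Nat.coprime_mul_iff_left.mpr ⟨hxk, hyk⟩⟩
  unfold dk
  rw [himage, Finset.card_image_of_injOn, Finset.card_product]
  refine hmn.mul_injOn_divisors.mono ?_
  exact_mod_cast Finset.product_subset_product (Finset.filter_subset _ _)
    (Finset.filter_subset _ _)

theorem construction_gives_solution
    (k B a a' r F r' F' : ℕ)
    (hk : 0 < k) (hB : 0 < B) (ha' : 0 < a') (haa' : a' < a)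
    (hda : (a - a') ∣ a) (hda' : (a - a') ∣ a')
    (hr : 0 < r) (hF : 0 < F) (hr' : 0 < r') (hF' : 0 < F')
    (h1 : (B * a / (a - a')) * r' * F' = B + (B * a' / (a - a')) * r * F)
    (h2a : Nat.Coprime (B * a' / (a - a')) r)
    (h2b : Nat.Coprime (B * a' / (a - a')) F)
    (h2c : Nat.Coprime r F)
    (h2d : Nat.Coprime (B * a / (a - a')) r')
    (h2e : Nat.Coprime (B * a / (a - a')) F')
    (h2f : Nat.Coprime r' F')
    (h3a : dk k r = dk k (B * a))
    (h3b : dk k r' = dk k (B * a'))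
    (h4 : dk k (B * a') * dk k (B * a / (a - a')) = dk k (B * a) * dk k (B * a' / (a - a')))
    (h5 : dk k F = dk k F') :
    dk k ((B * a' / (a - a')) * r * F) = dk k ((B * a' / (a - a')) * r * F + B) := by
  rw [add_comm _ B, ← h1, dk_mul_of_coprime k (Nat.Coprime.mul_left h2b h2c),
    dk_mul_of_coprime k h2a, dk_mul_of_coprime k (Nat.Coprime.mul_left h2e h2f),
    dk_mul_of_coprime k h2d, h3a, h3b, h5]
  congr 1
  rw [mul_comm, ← h4, mul_comm]
end

section
/- Let N ≥ 1, let c_0, ..., c_{N-1} be distinct integers, and let Q be a positive integer such that every prime not dividing Q is greater than N, and such that Q > |c_n - c_m| for all n, m. Then there exist integers β_0 = 0, β_1, ..., β_{N-1} such that for every prime p not dividing Q, p^2 does not divide the product over all pairs 0 ≤ n < m ≤ N-1 of (c_n - c_m + (β_n - β_m)·Q). In particular every factor c_n - c_m + (β_n - β_m)·Q is nonzero, and for each prime p not dividing Q, p divides at most one of these factors and divides it at most to the first power. -/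
theorem card_filter_sq_dvd_linear_le (a d : ℤ) (p T : ℕ) (hp : p.Prime) (hpd : ¬ (p : ℤ) ∣ d) :
    (((Finset.range T).filter (fun t : ℕ => (p : ℤ) ^ 2 ∣ a + d * t)).card : ℚ) ≤
      T * ((p : ℚ) ^ 2)⁻¹ + 1 := by
  have hp2 : 0 < p ^ 2 := pow_pos hp.pos 2
  rcases Finset.eq_empty_or_nonempty
    ((Finset.range T).filter (fun t : ℕ => (p : ℤ) ^ 2 ∣ a + d * t)) with h | ⟨t₀, ht₀⟩
  · rw [h, Finset.card_empty]
    positivity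
  · have hsub : (Finset.range T).filter (fun t : ℕ => (p : ℤ) ^ 2 ∣ a + d * t) ⊆
        (Finset.range T).filter (fun t : ℕ => t ≡ t₀ [MOD p ^ 2]) := by
      intro t ht
      rw [Finset.mem_filter] at ht ht₀ ⊢
      refine ⟨ht.1, ?_⟩
      have hdvd : (p : ℤ) ^ 2 ∣ d * (t₀ - t) := by
        have hdiff : d * (t₀ - t) = (a + d * t₀) - (a + d * t) := by ring
        exact hdiff ▸ dvd_sub ht₀.2 ht.2
      have hcop : IsCoprime ((p : ℤ) ^ 2) d :=
        ((Nat.prime_iff_prime_int.mp hp).coprime_iff_not_dvd.mpr hpd).pow_left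
      rw [Nat.modEq_iff_dvd]
      exact_mod_cast hcop.dvd_of_dvd_mul_left hdvd
    have hcard := Finset.card_le_card hsub
    rw [← Nat.count_eq_card_filter_range (fun t => t ≡ t₀ [MOD p ^ 2]), Nat.count_modEq_card _ hp2] at hcard
    have hdiv : ((T / p ^ 2 : ℕ) : ℚ) ≤ T * ((p : ℚ) ^ 2)⁻¹ := by
      have := @Nat.cast_div_le ℚ _ _ _ T (p ^ 2)
      rwa [Nat.cast_pow, div_eq_mul_inv] at this
    have hle : ((Finset.range T).filter (fun t : ℕ => (p : ℤ) ^ 2 ∣ a + d * t)).card ≤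
        T / p ^ 2 + 1 := by
      split_ifs at hcard <;> omega
    have : (((Finset.range T).filter (fun t : ℕ => (p : ℤ) ^ 2 ∣ a + d * t)).card : ℚ) ≤
        ((T / p ^ 2 : ℕ) : ℚ) + 1 := by exact_mod_cast hle
    linarith

theorem exists_forall_not_prime_sq_dvd_linear {ι : Type*} (s : Finset ι) (N : ℕ)
    (hs : s.card < N) (a : ι → ℤ) (d : ℤ) (h0 : ∀ i ∈ s, ∀ t : ℕ, a i + d * t ≠ 0) :
    ∃ t : ℕ, ∀ i ∈ s, ∀ p : ℕ, p.Prime → N < p → ¬ (p : ℤ) ∣ d →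
      ¬ (p : ℤ) ^ 2 ∣ a i + d * t := by
  classical
  by_contra! hcon
  set C : ℕ := ∑ i ∈ s, (a i).natAbs + d.natAbs + 1 with hC
  set T : ℕ := N ^ 4 * C with hT
  set L : ℕ := N ^ 2 * C with hL
  have hN : 1 ≤ N := by omega
  have hC1 : 1 ≤ C := by omega
  have hT1 : 1 ≤ T := Nat.mul_pos (pow_pos hN 4) hC1
  have hNL : N ≤ L := by
    rw [hL]
    nlinarith [Nat.mul_le_mul hN hC1, Nat.mul_le_mul (Nat.mul_le_mul hN (le_refl N)) hC1]
  let P : Finset ℕ := (Finset.Ioc N L).filter (fun p => p.Prime ∧ ¬ (p : ℤ) ∣ d)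
  let A : ι → ℕ → Finset ℕ := fun i p =>
    (Finset.range T).filter (fun t : ℕ => (p : ℤ) ^ 2 ∣ a i + d * t)
  have hcover : Finset.range T ⊆ s.biUnion (fun i => P.biUnion (A i)) := by
    intro t ht
    obtain ⟨i, hi, p, hp, hNp, hpd, hdvd⟩ := hcon t
    simp only [Finset.mem_biUnion]
    refine ⟨i, hi, p, ?_, Finset.mem_filter.mpr ⟨ht, hdvd⟩⟩
    refine Finset.mem_filter.mpr ⟨Finset.mem_Ioc.mpr ⟨hNp, ?_⟩, hp, hpd⟩
    have htT : t < T := Finset.mem_range.mp ht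
    have h1 : p ^ 2 ≤ (a i + d * t).natAbs := by
      refine Nat.le_of_dvd (Int.natAbs_pos.mpr (h0 i hi t)) ?_
      rw [← Int.natCast_dvd]
      exact_mod_cast hdvd
    have h2 : (a i + d * t).natAbs ≤ (a i).natAbs + d.natAbs * t := by
      refine (Int.natAbs_add_le _ _).trans ?_
      rw [Int.natAbs_mul, Int.natAbs_natCast]
    have h3 : (a i).natAbs ≤ ∑ i ∈ s, (a i).natAbs :=
      Finset.single_le_sum (f := fun i => (a i).natAbs) (fun _ _ => Nat.zero_le _) hi
    have h4 : (a i).natAbs + d.natAbs * t ≤ C * T := by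
      calc (a i).natAbs + d.natAbs * t ≤ (a i).natAbs * T + d.natAbs * T := by
            gcongr
            exact Nat.le_mul_of_pos_right _ hT1
        _ = ((a i).natAbs + d.natAbs) * T := by ring
        _ ≤ C * T := by
            gcongr
            omega
    have h5 : C * T = L ^ 2 := by rw [hT, hL]; ring
    exact (Nat.pow_le_pow_iff_left two_ne_zero).mp (by omega)
  have hsumP : ∀ i ∈ s, ((P.biUnion (A i)).card : ℚ) ≤ T * (N : ℚ)⁻¹ + L := by
    intro i _
    calc ((P.biUnion (A i)).card : ℚ) ≤ ∑ p ∈ P, ((A i p).card : ℚ) := by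
          exact_mod_cast Finset.card_biUnion_le
      _ ≤ ∑ p ∈ P, (T * ((p : ℚ) ^ 2)⁻¹ + 1) := by
          refine Finset.sum_le_sum fun p hp => ?_
          obtain ⟨_, hp', hpd⟩ := Finset.mem_filter.mp hp
          exact card_filter_sq_dvd_linear_le _ _ _ _ hp' hpd
      _ ≤ ∑ p ∈ Finset.Ioc N L, (T * ((p : ℚ) ^ 2)⁻¹ + 1) :=
          Finset.sum_le_sum_of_subset_of_nonneg (Finset.filter_subset _ _)
            fun _ _ _ => by positivity
      _ = T * ∑ p ∈ Finset.Ioc N L, ((p : ℚ) ^ 2)⁻¹ + (L - N : ℕ) := by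
          rw [Finset.sum_add_distrib, Finset.mul_sum]
          simp
      _ ≤ T * (N : ℚ)⁻¹ + L := by
          have hsum := sum_Ioc_inv_sq_le_sub (α := ℚ) (k := N) (n := L) (by omega) hNL
          have hLinv : (0 : ℚ) ≤ (L : ℚ)⁻¹ := by positivity
          gcongr
          · linarith
          · omega
  have hcard : (T : ℚ) ≤ s.card * (T * (N : ℚ)⁻¹ + L) := by
    calc (T : ℚ) = ((Finset.range T).card : ℚ) := by rw [Finset.card_range]
      _ ≤ ∑ i ∈ s, ((P.biUnion (A i)).card : ℚ) := by
          exact_mod_cast (Finset.card_le_card hcover).trans Finset.card_biUnion_le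
      _ ≤ ∑ i ∈ s, (T * (N : ℚ)⁻¹ + L) := Finset.sum_le_sum hsumP
      _ = s.card * (T * (N : ℚ)⁻¹ + L) := by rw [Finset.sum_const, nsmul_eq_mul]
  have hNq : (1 : ℚ) ≤ N := by exact_mod_cast hN
  have hCq : (1 : ℚ) ≤ C := by exact_mod_cast hC1
  have hsq : (s.card : ℚ) ≤ N - 1 := by
    have : (s.card : ℚ) + 1 ≤ N := by exact_mod_cast hs
    linarith
  have hval : (T : ℚ) * (N : ℚ)⁻¹ + L = C * (N ^ 3 + N ^ 2) := by
    rw [hT, hL]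
    push_cast
    field_simp
  have hlt : (N - 1 : ℚ) * (C * (N ^ 3 + N ^ 2)) < T := by
    rw [hT]
    push_cast
    have : (0 : ℚ) < C * N ^ 2 := by positivity
    nlinarith
  rw [hval] at hcard
  have : (s.card : ℚ) * (C * (N ^ 3 + N ^ 2)) ≤ (N - 1) * (C * (N ^ 3 + N ^ 2)) := by gcongr
  linarith

theorem exists_nat_forall_prime_not_dvd {ι : Type*} (s : Finset ι) (S : Finset ℕ)
    (hS : ∀ p ∈ S, p.Prime ∧ s.card < p) (a : ι → ℤ) (q : ℤ) (hq : ∀ p ∈ S, ¬ (p : ℤ) ∣ q) :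
    ∃ r : ℕ, ∀ p ∈ S, ∀ i ∈ s, ¬ (p : ℤ) ∣ a i + q * r := by
  classical
  have hlocal : ∀ p ∈ S, ∃ r : ℕ, ∀ i ∈ s, ¬ (p : ℤ) ∣ a i + q * r := by
    intro p hp
    have : Fact p.Prime := ⟨(hS p hp).1⟩
    have hq0 : (q : ZMod p) ≠ 0 := fun h =>
      hq p hp ((ZMod.intCast_zmod_eq_zero_iff_dvd q p).mp h)
    obtain ⟨r, hr⟩ : ∃ r : ZMod p, r ∉ s.image (fun i => -(a i : ZMod p) / q) := by
      by_contra! h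
      have := (Finset.card_le_card fun x (_ : x ∈ Finset.univ) => h x).trans Finset.card_image_le
      rw [Finset.card_univ, ZMod.card] at this
      exact absurd (hS p hp).2 (by omega)
    refine ⟨r.val, fun i hi hdvd => hr (Finset.mem_image.mpr ⟨i, hi, ?_⟩)⟩
    rw [← ZMod.intCast_zmod_eq_zero_iff_dvd] at hdvd
    push_cast [ZMod.natCast_zmod_val] at hdvd
    rw [div_eq_iff hq0]
    linear_combination -hdvd
  choose! f hf using hlocal
  obtain ⟨r, hr⟩ := Nat.chineseRemainderOfFinset f id S (fun p hp => (hS p hp).1.ne_zero)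
    (fun p hp p' hp' hne => (Nat.coprime_primes (hS p hp).1 (hS p' hp').1).mpr hne)
  refine ⟨r, fun p hp i hi hdvd => hf p hp i hi ?_⟩
  have h1 : (p : ℤ) ∣ (f p : ℤ) - r := Nat.modEq_iff_dvd.mp (hr p hp)
  have hsum : a i + q * f p = (a i + q * r) + q * (f p - r) := by ring
  exact hsum ▸ dvd_add hdvd (h1.mul_left q)

theorem exists_not_prime_sq_dvd_mul_prod {ι : Type*} (s : Finset ι) (N Q : ℕ)
    (hs : s.card < N) (hprimes : ∀ p : ℕ, p.Prime → ¬ p ∣ Q → N < p) (x : ι → ℤ) (c D : ℤ)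
    (hD : ∀ p : ℕ, p.Prime → ¬ p ∣ Q → ¬ (p : ℤ) ^ 2 ∣ D) (hQ : 0 < Q)
    (hpair : ∀ i ∈ s, ∀ j ∈ s, i ≠ j → x i - x j ∣ D)
    (h0 : ∀ i ∈ s, ¬ (Q : ℤ) ∣ x i - c) :
    ∃ b : ℤ, ∀ p : ℕ, p.Prime → ¬ p ∣ Q →
      ¬ (p : ℤ) ^ 2 ∣ D * ∏ i ∈ s, (x i - (c + b * Q)) := by
  classical
  have hD0 : D ≠ 0 := by
    rintro rfl
    obtain ⟨p, hle, hp⟩ := Nat.exists_infinite_primes (Q + 1)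
    exact hD p hp (fun h => absurd (Nat.le_of_dvd hQ h) (by omega)) (dvd_zero _)
  let S : Finset ℕ := D.natAbs.primeFactors.filter (fun p => ¬ p ∣ Q)
  have hmemS : ∀ p : ℕ, p ∈ S ↔ p.Prime ∧ (p : ℤ) ∣ D ∧ ¬ p ∣ Q := by
    intro p
    simp only [S, Finset.mem_filter, Nat.mem_primeFactors, Int.natCast_dvd, ne_eq,
      Int.natAbs_eq_zero]
    tauto
  obtain ⟨r, hr⟩ := exists_nat_forall_prime_not_dvd s S
    (fun p hp => by
      obtain ⟨hp', _, hpQ⟩ := (hmemS p).mp hp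
      exact ⟨hp', hs.trans (hprimes p hp' hpQ)⟩)
    (fun i => x i - c) (-Q)
    (fun p hp => by
      rw [dvd_neg, Int.natCast_dvd_natCast]
      exact ((hmemS p).mp hp).2.2)
  let M : ℕ := ∏ p ∈ S, p
  obtain ⟨t, ht⟩ := exists_forall_not_prime_sq_dvd_linear s N hs
    (fun i => x i - c - Q * r) (-(Q * M : ℕ)) (fun i hi t h => h0 i hi ⟨r + M * t, by
      push_cast at h
      linear_combination h⟩)
  refine ⟨r + M * t, fun p hp hpQ hdvd => ?_⟩
  have hpZ : Prime (p : ℤ) := Nat.prime_iff_prime_int.mp hp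
  by_cases hpD : (p : ℤ) ∣ D
  · have hpS : p ∈ S := (hmemS p).mpr ⟨hp, hpD, hpQ⟩
    refine hD p hp hpQ (hpZ.pow_dvd_of_dvd_mul_right 2 (fun h => ?_) hdvd)
    obtain ⟨i, hi, hpi⟩ := hpZ.exists_mem_finset_dvd h
    refine hr p hpS i hi ?_
    have hpM : (p : ℤ) ∣ M := Int.natCast_dvd_natCast.mpr (Finset.dvd_prod_of_mem _ hpS)
    have hsum : x i - c + -Q * r = (x i - (c + (r + M * t) * Q)) + M * (t * Q) := by ring
    exact hsum ▸ dvd_add hpi (hpM.mul_right _)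
  · have hprod := hpZ.pow_dvd_of_dvd_mul_left 2 hpD hdvd
    obtain ⟨i, hi, hpi⟩ := hpZ.exists_mem_finset_dvd ((dvd_pow_self _ two_ne_zero).trans hprod)
    rw [← Finset.mul_prod_erase s _ hi] at hprod
    have hpi2 := hpZ.pow_dvd_of_dvd_mul_right 2 (fun h => by
      obtain ⟨j, hj, hpj⟩ := hpZ.exists_mem_finset_dvd h
      obtain ⟨hne, hj⟩ := Finset.mem_erase.mp hj
      refine hpD (dvd_trans ?_ (hpair j hj i hi hne))
      simpa using dvd_sub hpj hpi) hprod
    refine ht i hi p hp (hprimes p hp hpQ) ?_ ?_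
    · rw [dvd_neg, Int.natCast_dvd_natCast, hp.dvd_mul, not_or]
      refine ⟨hpQ, fun h => ?_⟩
      obtain ⟨q, hq, hpq⟩ := (Nat.prime_iff.mp hp).exists_mem_finset_dvd h
      obtain ⟨hq', hqD, _⟩ := (hmemS q).mp hq
      exact hpD (((Nat.prime_dvd_prime_iff_eq hp hq').mp hpq) ▸ hqD)
    · have heq : x i - c - Q * r + -((Q * M : ℕ) : ℤ) * t =
          x i - (c + (r + M * t) * Q) := by
        push_cast
        ring
      exact heq ▸ hpi2

theorem exists_not_prime_sq_dvd_prod_of_lt {N : ℕ} (c : Fin N → ℤ) (hc : Function.Injective c)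
    (Q : ℕ) (hQ : 0 < Q) (hprimes : ∀ p : ℕ, p.Prime → ¬ p ∣ Q → N < p)
    (hbound : ∀ n m : Fin N, |c n - c m| < (Q : ℤ)) (k : ℕ) (hk : k ≤ N) :
    ∃ β : Fin N → ℤ, ∀ p : ℕ, p.Prime → ¬ p ∣ Q →
      ¬ ((p : ℤ) ^ 2 ∣
        ∏ nm ∈ Finset.univ.filter (fun nm : Fin N × Fin N => nm.1 < nm.2 ∧ nm.2 < k),
          (c nm.1 - c nm.2 + (β nm.1 - β nm.2) * Q)) := by
  induction k with
  | zero =>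
    refine ⟨0, fun p hp _ h => ?_⟩
    simp only [Nat.not_lt_zero, and_false, Finset.filter_false, Finset.prod_empty] at h
    exact (Nat.prime_iff_prime_int.mp hp).not_isUnit
      (isUnit_of_dvd_one ((dvd_pow_self _ two_ne_zero).trans h))
  | succ k ih =>
    obtain ⟨β, hβ⟩ := ih (by omega)
    let l : Fin N := ⟨k, hk⟩
    obtain ⟨b, hb⟩ := exists_not_prime_sq_dvd_mul_prod (Finset.Iio l) N Q
      (by rw [Fin.card_Iio]; exact hk) hprimes (fun n => c n + β n * Q) (c l) _ hβ hQ
      (by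
        have hlt : ∀ i ∈ Finset.Iio l, ∀ j ∈ Finset.Iio l, i < j →
            c i + β i * Q - (c j + β j * Q) ∣
            ∏ nm ∈ Finset.univ.filter (fun nm : Fin N × Fin N => nm.1 < nm.2 ∧ nm.2 < k),
              (c nm.1 - c nm.2 + (β nm.1 - β nm.2) * Q) := by
          intro i _ j hj hij
          have hmem : (i, j) ∈
              Finset.univ.filter (fun nm : Fin N × Fin N => nm.1 < nm.2 ∧ nm.2 < k) :=
            Finset.mem_filter.mpr ⟨Finset.mem_univ _, hij, Fin.lt_def.mp (Finset.mem_Iio.mp hj)⟩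
          have heq : c i + β i * Q - (c j + β j * Q) = c i - c j + (β i - β j) * Q := by ring
          rw [heq]
          exact Finset.dvd_prod_of_mem
            (fun nm : Fin N × Fin N => c nm.1 - c nm.2 + (β nm.1 - β nm.2) * Q) hmem
        intro i hi j hj hne
        rcases lt_or_gt_of_ne hne with h | h
        · exact hlt i hi j hj h
        · rw [← neg_dvd, neg_sub]
          exact hlt j hj i hi h)
      (by
        intro i hi hdvd
        have hdvd' : (Q : ℤ) ∣ c i - c l := by
          have hdiff : c i - c l = (c i + β i * Q - c l) - β i * Q := by ring
          exact hdiff ▸ dvd_sub hdvd (dvd_mul_left _ _)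
        have heq := Int.eq_zero_of_abs_lt_dvd hdvd' (hbound i l)
        exact (Finset.mem_Iio.mp hi).ne (hc (sub_eq_zero.mp heq)))
    refine ⟨Function.update β l b, fun p hp hpQ => ?_⟩
    convert hb p hp hpQ using 2
    have hsplit : Finset.univ.filter (fun nm : Fin N × Fin N => nm.1 < nm.2 ∧ nm.2 < k + 1) =
        Finset.univ.filter (fun nm : Fin N × Fin N => nm.1 < nm.2 ∧ nm.2 < k) ∪
          Finset.Iio l ×ˢ {l} := by
      ext ⟨i, j⟩
      simp only [Finset.mem_filter, Finset.mem_univ, true_and, Finset.mem_union,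
        Finset.mem_product, Finset.mem_Iio, Finset.mem_singleton, l, Fin.lt_def, Fin.ext_iff]
      omega
    have hdisj : Disjoint
        (Finset.univ.filter (fun nm : Fin N × Fin N => nm.1 < nm.2 ∧ nm.2 < k))
        (Finset.Iio l ×ˢ {l}) := by
      rw [Finset.disjoint_left]
      rintro ⟨i, j⟩ h h'
      simp only [Finset.mem_filter, Finset.mem_univ, true_and, Finset.mem_product,
        Finset.mem_singleton, l, Fin.ext_iff] at h h'
      omega
    rw [hsplit, Finset.prod_union hdisj, Finset.prod_product]
    congr 1
    · refine Finset.prod_congr rfl fun nm hnm => ?_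
      obtain ⟨_, h1, h2⟩ := Finset.mem_filter.mp hnm
      have hne2 : nm.2 ≠ l := fun h => by simp [h, l] at h2
      have hne1 : nm.1 ≠ l := fun h => by
        rw [h, Fin.lt_def] at h1
        simp only [l] at h1
        omega
      rw [Function.update_of_ne hne1, Function.update_of_ne hne2]
    · refine Finset.prod_congr rfl fun i hi => ?_
      rw [Finset.prod_singleton, Function.update_self,
        Function.update_of_ne (Finset.mem_Iio.mp hi).ne]
      ring

theorem exists_beta_avoiding_prime_squares
    (N : ℕ) (hN : 1 ≤ N) (c : Fin N → ℤ) (hc : Function.Injective c)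
    (Q : ℕ) (hQ : 0 < Q)
    (hprimes : ∀ p : ℕ, p.Prime → ¬ p ∣ Q → N < p)
    (hbound : ∀ n m : Fin N, |c n - c m| < (Q : ℤ)) :
    ∃ β : Fin N → ℤ, β ⟨0, hN⟩ = 0 ∧
      ∀ p : ℕ, p.Prime → ¬ p ∣ Q →
        ¬ ((p : ℤ) ^ 2 ∣
          ∏ nm ∈ Finset.univ.filter (fun nm : Fin N × Fin N => nm.1 < nm.2),
            (c nm.1 - c nm.2 + (β nm.1 - β nm.2) * Q)) := by
  obtain ⟨β, hβ⟩ := exists_not_prime_sq_dvd_prod_of_lt c hc Q hQ hprimes hbound N le_rfl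
  refine ⟨fun n => β n - β ⟨0, hN⟩, sub_self _, fun p hp hpQ => ?_⟩
  simpa only [Fin.is_lt, and_true, sub_sub_sub_cancel_right] using hβ p hp hpQ
end
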